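/- For every n ≥ 1 and every t₀ > 0 (noting R_n(t₀) > 0), the function t ↦ r_n(t) has a derivative at t₀ satisfying r_n'(t₀) = −2(−1)^n r_n(t₀)/R_n(t₀) − (n + r_n(t₀)) R_n(t₀)/(2t₀). -/

import Mathlib

open MeasureTheory Polynomial

/-- The singularly perturbed Gaussian weight `w(x,t) = exp(-x^2 - t/x^2)` for `x ≠ 0`,
extended by `0` at `x = 0`. -/
noncomputable def w (t x : ℝ) : ℝ := if x = 0 then 0 else Real.exp (-x ^ 2 - t / x ^ 2)

lemma w_zero (t : ℝ) : w t 0 = 0 := by simp [w]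

lemma w_of_ne {x : ℝ} (hx : x ≠ 0) (t : ℝ) : w t x = Real.exp (-x ^ 2 - t / x ^ 2) := by
  simp [w, hx]

lemma w_nonneg (t x : ℝ) : 0 ≤ w t x := by
  unfold w; split_ifs <;> positivity

lemma w_neg (t x : ℝ) : w t (-x) = w t x := by simp [w]

lemma w_antitone {s t : ℝ} (hst : s ≤ t) (x : ℝ) : w t x ≤ w s x := by
  unfold w
  split_ifs
  · rfl
  · gcongr

lemma measurable_w (t : ℝ) : Measurable (w t) := by
  unfold w
  exact Measurable.ite (measurableSet_singleton 0) measurable_const (by fun_prop)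

lemma inv_sq_pow_mul_w_le {t : ℝ} (ht : 0 < t) (m : ℕ) (x : ℝ) :
    (x ^ 2)⁻¹ ^ m * w t x ≤ m.factorial / t ^ m * Real.exp (-x ^ 2) := by
  rcases eq_or_ne x 0 with rfl | hx
  · rw [w_zero, mul_zero]; positivity
  · have hpow := Real.pow_div_factorial_le_exp (t / x ^ 2) (by positivity) m
    rw [w_of_ne hx, sub_eq_add_neg, Real.exp_add, Real.exp_neg (t / x ^ 2)]
    have he := Real.exp_pos (t / x ^ 2)
    have key : (x ^ 2)⁻¹ ^ m * (Real.exp (t / x ^ 2))⁻¹ ≤ m.factorial / t ^ m := by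
      rw [← div_eq_mul_inv, div_le_iff₀ he]
      calc (x ^ 2)⁻¹ ^ m = m.factorial / t ^ m * ((t / x ^ 2) ^ m / m.factorial) := by
            rw [div_pow, inv_pow]; field_simp
        _ ≤ _ := by gcongr
    calc _ = (x ^ 2)⁻¹ ^ m * (Real.exp (t / x ^ 2))⁻¹ * Real.exp (-x ^ 2) := by ring
      _ ≤ _ := by gcongr

/-- The weight is differentiable everywhere, including at its essential singularity. -/
lemma hasDerivAt_w {t : ℝ} (ht : 0 < t) (x : ℝ) :
    HasDerivAt (w t) ((-2 * x + 2 * t * x * (x ^ 2)⁻¹ ^ 2) * w t x) x := by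
  rcases eq_or_ne x 0 with rfl | hx
  · have hO : w t =O[nhds 0] fun x => ‖x - 0‖ ^ 2 := by
      refine Asymptotics.IsBigO.of_bound (1 / t) (Filter.Eventually.of_forall fun x => ?_)
      have hle := inv_sq_pow_mul_w_le ht 1 x
      have he : Real.exp (-x ^ 2) ≤ 1 := Real.exp_le_one_iff.2 (by nlinarith [sq_nonneg x])
      rw [Real.norm_of_nonneg (w_nonneg t x)]
      rcases eq_or_ne x 0 with rfl | hx
      · simp [w_zero]
      · simp only [pow_one, Nat.factorial_one, Nat.cast_one] at hle
        have hle' : (x ^ 2)⁻¹ * w t x ≤ 1 / t := hle.trans (mul_le_of_le_one_right (by positivity) he)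
        rw [inv_mul_le_iff₀ (by positivity)] at hle'
        simpa [mul_comm] using hle'
    have := (hO.hasFDerivAt (by norm_num)).hasDerivAt
    simpa [w_zero] using this
  · have hev : w t =ᶠ[nhds x] fun y => Real.exp (-y ^ 2 - t / y ^ 2) := by
      filter_upwards [isOpen_ne.mem_nhds hx] with y hy using w_of_ne hy t
    rw [w_of_ne hx]
    refine HasDerivAt.congr_of_eventuallyEq ?_ hev
    have h1 : HasDerivAt (fun y : ℝ => -y ^ 2 - t / y ^ 2)
        (-2 * x + 2 * t * x * (x ^ 2)⁻¹ ^ 2) x := by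
      have := (hasDerivAt_pow 2 x).neg.sub
        ((hasDerivAt_const x t).fun_div (hasDerivAt_pow 2 x) (by positivity))
      refine this.congr_deriv ?_
      field_simp
      norm_num
      ring
    simpa [mul_comm] using h1.exp

lemma hasDerivAt_w_param (s x : ℝ) : HasDerivAt (fun s => w s x) (-((x ^ 2)⁻¹ * w s x)) s := by
  rcases eq_or_ne x 0 with rfl | hx
  · simpa [w_zero] using hasDerivAt_const s (0 : ℝ)
  · simp only [w_of_ne hx]
    have := ((hasDerivAt_id s).div_const (x ^ 2)).const_sub (-x ^ 2) |>.exp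
    refine this.congr_deriv ?_
    simp only [id]
    ring

lemma integrable_pow_mul_exp_neg_sq (k : ℕ) :
    Integrable fun x : ℝ => x ^ k * Real.exp (-x ^ 2) := by
  have := integrable_rpow_mul_exp_neg_mul_sq one_pos (s := k) (by linarith [k.cast_nonneg (α := ℝ)])
  simpa using this

lemma integrable_eval_mul_w {t : ℝ} (ht : 0 < t) (m : ℕ) (p : ℝ[X]) :
    Integrable fun x => p.eval x * (x ^ 2)⁻¹ ^ m * w t x := by
  induction p using Polynomial.induction_on' with
  | add p q hp hq =>
    simp only [eval_add, add_mul]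
    exact hp.add hq
  | monomial k a =>
    refine (((integrable_pow_mul_exp_neg_sq k).norm.const_mul
      (|a| * (m.factorial / t ^ m))).mono' ?_ (.of_forall fun x => ?_))
    · have := measurable_w t
      exact Measurable.aestronglyMeasurable (by fun_prop)
    · have hle := inv_sq_pow_mul_w_le ht m x
      have h0 : 0 ≤ (x ^ 2)⁻¹ ^ m * w t x := mul_nonneg (by positivity) (w_nonneg t x)
      rw [eval_monomial, mul_assoc, norm_mul (a * x ^ k), norm_mul a, norm_mul (x ^ k),
        Real.norm_of_nonneg h0, Real.norm_of_nonneg (Real.exp_pos _).le, Real.norm_eq_abs a]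
      calc _ ≤ |a| * ‖x ^ k‖ * (m.factorial / t ^ m * Real.exp (-x ^ 2)) := by gcongr
        _ = _ := by ring

/-- The moment functional `p ↦ ∫ p(x) x^{-2m} w(x,t) dx` on polynomials. -/
noncomputable def moment (t : ℝ) (m : ℕ) (p : ℝ[X]) : ℝ :=
  ∫ x, p.eval x * (x ^ 2)⁻¹ ^ m * w t x

lemma moment_add {t : ℝ} (ht : 0 < t) (m : ℕ) (p q : ℝ[X]) :
    moment t m (p + q) = moment t m p + moment t m q := by
  unfold moment
  rw [← integral_add (integrable_eval_mul_w ht m p) (integrable_eval_mul_w ht m q)]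
  simp [add_mul]

lemma moment_C_mul (t : ℝ) (m : ℕ) (a : ℝ) (p : ℝ[X]) :
    moment t m (C a * p) = a * moment t m p := by
  unfold moment
  rw [← integral_const_mul]
  simp [mul_assoc]

lemma moment_zero (t : ℝ) (m : ℕ) : moment t m 0 = 0 := by simp [moment]

lemma moment_sub {t : ℝ} (ht : 0 < t) (m : ℕ) (p q : ℝ[X]) :
    moment t m (p - q) = moment t m p - moment t m q := by
  unfold moment
  rw [← integral_sub (integrable_eval_mul_w ht m p) (integrable_eval_mul_w ht m q)]
  simp [sub_mul]

lemma moment_sum {t : ℝ} (ht : 0 < t) (m : ℕ) {ι : Type*} (s : Finset ι) (f : ι → ℝ[X]) :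
    moment t m (∑ i ∈ s, f i) = ∑ i ∈ s, moment t m (f i) := by
  classical
  induction s using Finset.induction_on with
  | empty => simp [moment_zero]
  | insert i s hi ih => rw [Finset.sum_insert hi, Finset.sum_insert hi, moment_add ht, ih]

lemma moment_succ_X_sq_mul (t : ℝ) (m : ℕ) (p : ℝ[X]) :
    moment t (m + 1) (X ^ 2 * p) = moment t m p := by
  unfold moment
  congr 1 with x
  rcases eq_or_ne x 0 with rfl | hx
  · simp [w_zero]
  · simp only [eval_mul, eval_pow, eval_X]
    have hx2 : x ^ 2 * (x ^ 2)⁻¹ = 1 := mul_inv_cancel₀ (by positivity)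
    linear_combination (eval x p * (x ^ 2)⁻¹ ^ m * w t x) * hx2

lemma moment_comp_neg (t : ℝ) (m : ℕ) (p : ℝ[X]) :
    moment t m (p.comp (C (-1) * X)) = moment t m p := by
  unfold moment
  rw [← integral_neg_eq_self]
  simp [w_neg]

/-- Integration by parts against the weight. -/
lemma moment_derivative {t : ℝ} (ht : 0 < t) (p : ℝ[X]) :
    moment t 0 (derivative p) = 2 * moment t 0 (X * p) - 2 * t * moment t 2 (X * p) := by
  have h1 := integrable_eval_mul_w ht 0 (derivative p)
  have h2 := integrable_eval_mul_w ht 0 (X * p)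
  have h3 := integrable_eval_mul_w ht 2 (X * p)
  have hder : ∀ x, HasDerivAt (fun x => p.eval x * (x ^ 2)⁻¹ ^ 0 * w t x)
      ((derivative p).eval x * (x ^ 2)⁻¹ ^ 0 * w t x
        - 2 * ((X * p).eval x * (x ^ 2)⁻¹ ^ 0 * w t x)
        + 2 * t * ((X * p).eval x * (x ^ 2)⁻¹ ^ 2 * w t x)) x := by
    intro x
    simp only [pow_zero, mul_one, eval_mul, eval_X]
    exact ((p.hasDerivAt x).fun_mul (hasDerivAt_w ht x)).congr_deriv (by ring)
  have h12 : Integrable fun x => (derivative p).eval x * (x ^ 2)⁻¹ ^ 0 * w t x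
      - 2 * ((X * p).eval x * (x ^ 2)⁻¹ ^ 0 * w t x) := h1.sub (h2.const_mul 2)
  have := integral_eq_zero_of_hasDerivAt_of_integrable hder
    (h12.add (h3.const_mul (2 * t))) (integrable_eval_mul_w ht 0 p)
  rw [integral_add h12 (h3.const_mul (2 * t)),
    integral_sub h1 (h2.const_mul 2), integral_const_mul, integral_const_mul] at this
  unfold moment
  linarith

lemma hasDerivAt_moment {t : ℝ} (ht : 0 < t) (p : ℝ[X]) :
    HasDerivAt (fun s => moment s 0 p) (-moment t 1 p) t := by
  have hm := measurable_w
  have := (hasDerivAt_integral_of_dominated_loc_of_deriv_le (μ := volume) (s := Set.Ioi (t / 2))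
    (F := fun s x => p.eval x * (x ^ 2)⁻¹ ^ 0 * w s x)
    (F' := fun s x => p.eval x * (-((x ^ 2)⁻¹ * w s x)))
    (bound := fun x => ‖p.eval x * (x ^ 2)⁻¹ ^ 1 * w (t / 2) x‖) (Ioi_mem_nhds (by linarith))
    (.of_forall fun s => Measurable.aestronglyMeasurable (by fun_prop))
    (integrable_eval_mul_w ht 0 p) (Measurable.aestronglyMeasurable (by fun_prop))
    (.of_forall fun x s hs => ?_) (integrable_eval_mul_w (half_pos ht) 1 p).norm
    (.of_forall fun x s hs => ?_)).2
  · refine this.congr_deriv ?_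
    unfold moment
    rw [← integral_neg]
    congr 1 with x
    ring
  · have hle : w s x ≤ w (t / 2) x := w_antitone (le_of_lt hs) x
    rw [pow_one, mul_assoc, norm_mul, norm_mul, norm_neg, norm_mul, norm_mul,
      Real.norm_of_nonneg (w_nonneg s x), Real.norm_of_nonneg (w_nonneg (t / 2) x)]
    gcongr
  · simpa using (hasDerivAt_w_param s x).const_mul (p.eval x)

/-- `p` is the sequence of monic orthogonal polynomials for the weight `w(·,t)`. -/
structure IsMonicOrthogonal (t : ℝ) (p : ℕ → ℝ[X]) : Prop where
  monic : ∀ n, (p n).Monic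
  natDegree_eq : ∀ n, (p n).natDegree = n
  orthogonal : ∀ m n, m ≠ n → moment t 0 (p m * p n) = 0
  norm_pos : ∀ n, 0 < moment t 0 (p n * p n)

namespace IsMonicOrthogonal

variable {t : ℝ} {p : ℕ → ℝ[X]}

lemma coeff_self (hp : IsMonicOrthogonal t p) (n : ℕ) : (p n).coeff n = 1 := by
  simpa [hp.natDegree_eq n] using (hp.monic n).coeff_natDegree

lemma coeff_of_lt (hp : IsMonicOrthogonal t p) {n k : ℕ} (h : n < k) : (p n).coeff k = 0 :=
  coeff_eq_zero_of_natDegree_lt (by rwa [hp.natDegree_eq n])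

/-- `p n` is orthogonal to every polynomial of degree less than `n`. -/
lemma moment_mul_eq_zero (ht : 0 < t) (hp : IsMonicOrthogonal t p) {n : ℕ} {q : ℝ[X]}
    (hq : ∀ k, n ≤ k → q.coeff k = 0) : moment t 0 (q * p n) = 0 := by
  have key : ∀ m, m ≤ n → ∀ q : ℝ[X], (∀ k, m ≤ k → q.coeff k = 0) →
      moment t 0 (q * p n) = 0 := by
    intro m
    induction m with
    | zero =>
      intro _ q hq
      have : q = 0 := by ext k; simpa using hq k k.zero_le
      simp [this, moment_zero]
    | succ m ih =>
      intro hmn q hq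
      have hsplit : q * p n = C (q.coeff m) * (p m * p n) + (q - C (q.coeff m) * p m) * p n := by
        ring
      rw [hsplit, moment_add ht, moment_C_mul, hp.orthogonal m n (by omega), mul_zero, zero_add]
      refine ih (by omega) _ fun k hk => ?_
      rw [coeff_sub, coeff_C_mul]
      rcases hk.eq_or_lt with rfl | hk
      · rw [hp.coeff_self, mul_one, sub_self]
      · rw [hq k hk, hp.coeff_of_lt hk, mul_zero, sub_zero]
  exact key n le_rfl q hq

/-- The norm of `p n` can be computed by pairing it with any monic polynomial of degree `n`. -/
lemma moment_mul_eq_norm (ht : 0 < t) (hp : IsMonicOrthogonal t p) {n : ℕ} {q : ℝ[X]}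
    (hn : q.coeff n = 1) (hq : ∀ k, n < k → q.coeff k = 0) :
    moment t 0 (q * p n) = moment t 0 (p n * p n) := by
  have hsplit : q * p n = p n * p n + (q - p n) * p n := by ring
  rw [hsplit, moment_add ht, hp.moment_mul_eq_zero ht (q := q - p n), add_zero]
  intro k hk
  rw [coeff_sub]
  rcases hk.eq_or_lt with rfl | hk
  · rw [hn, hp.coeff_self, sub_self]
  · rw [hq k hk, hp.coeff_of_lt hk, sub_zero]

/-- A polynomial of degree less than `n` orthogonal to `p 0, …, p (n - 1)` vanishes. -/
lemma eq_zero_of_orthogonal (ht : 0 < t) (hp : IsMonicOrthogonal t p) {n : ℕ} {q : ℝ[X]}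
    (hq : ∀ k, n ≤ k → q.coeff k = 0) (horth : ∀ m, m < n → moment t 0 (q * p m) = 0) :
    q = 0 := by
  by_contra hne
  have hlead : q.coeff q.natDegree ≠ 0 := leadingCoeff_ne_zero.2 hne
  have hlt : q.natDegree < n := by
    by_contra! hle
    exact hlead (hq _ hle)
  set m := q.natDegree with hm
  have hnorm := hp.moment_mul_eq_norm ht (n := m) (q := C (q.coeff m)⁻¹ * q)
    (by rw [coeff_C_mul, inv_mul_cancel₀ hlead])
    (fun k hk => by rw [coeff_C_mul, coeff_eq_zero_of_natDegree_lt hk, mul_zero])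
  rw [mul_assoc, moment_C_mul, horth m hlt, mul_zero] at hnorm
  exact (hp.norm_pos m).ne hnorm

/-- Since the weight is even, `p n` has the parity of `n`. -/
lemma coeff_eq_zero_of_odd (ht : 0 < t) (hp : IsMonicOrthogonal t p) {n k : ℕ}
    (hodd : Odd (n + k)) : (p n).coeff k = 0 := by
  set ρ : ℝ[X] := C (-1) * X
  have hρρ : ∀ q : ℝ[X], (q.comp ρ).comp ρ = q := fun q => by
    ext j
    rw [comp_C_mul_X_coeff, comp_C_mul_X_coeff, mul_assoc, ← mul_pow]
    norm_num
  have hzero : p n - C ((-1) ^ n) * (p n).comp ρ = 0 := by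
    refine hp.eq_zero_of_orthogonal ht (n := n) (fun j hj => ?_) fun m hm => ?_
    · rw [coeff_sub, coeff_C_mul, comp_C_mul_X_coeff]
      rcases hj.eq_or_lt with rfl | hj
      · rw [hp.coeff_self, one_mul, ← mul_pow]; norm_num
      · rw [hp.coeff_of_lt hj]; ring
    · have hcomp : (p n).comp ρ * p m = ((p m).comp ρ * p n).comp ρ := by
        rw [mul_comp, hρρ, mul_comm]
      rw [sub_mul, moment_sub ht, hp.orthogonal n m hm.ne', mul_assoc, moment_C_mul, hcomp,
        moment_comp_neg, hp.moment_mul_eq_zero ht, mul_zero, sub_zero]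
      intro j hj
      rw [comp_C_mul_X_coeff, hp.coeff_of_lt (hm.trans_le hj), zero_mul]
  have hk := congrArg (fun q => q.coeff k) hzero
  simp only [coeff_sub, coeff_C_mul, ρ, comp_C_mul_X_coeff, coeff_zero] at hk
  have hsign : (-1 : ℝ) ^ n * (-1) ^ k = -1 := by rw [← pow_add, hodd.neg_one_pow]
  linear_combination hk / 2 + (p n).coeff k / 2 * hsign

/-- Integration by parts gives `2 h (n+1) = h n (n + 1 + r (n+1))`. -/
lemma two_mul_norm_succ (ht : 0 < t) (hp : IsMonicOrthogonal t p) (n : ℕ) :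
    2 * moment t 0 (p (n + 1) * p (n + 1)) =
      (n + 1) * moment t 0 (p n * p n) + 2 * t * moment t 2 (X * (p (n + 1) * p n)) := by
  have hparts := moment_derivative ht (p (n + 1) * p n)
  have h1 : moment t 0 (derivative (p (n + 1)) * p n) = (n + 1) * moment t 0 (p n * p n) := by
    have hc : (n + 1 : ℝ) ≠ 0 := by positivity
    have := hp.moment_mul_eq_norm ht (n := n) (q := C (n + 1 : ℝ)⁻¹ * derivative (p (n + 1)))
      (by rw [coeff_C_mul, coeff_derivative, hp.coeff_self, one_mul, inv_mul_cancel₀ hc])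
      (fun k hk => by
        rw [coeff_C_mul, coeff_derivative, hp.coeff_of_lt (by omega), zero_mul, mul_zero])
    rw [mul_assoc, moment_C_mul] at this
    rw [← this, mul_inv_cancel_left₀ hc]
  have h2 : moment t 0 (derivative (p n) * p (n + 1)) = 0 :=
    hp.moment_mul_eq_zero ht fun k hk => by
      rw [coeff_derivative, hp.coeff_of_lt (by omega), zero_mul]
  have h3 : moment t 0 (X * p n * p (n + 1)) = moment t 0 (p (n + 1) * p (n + 1)) := by
    refine hp.moment_mul_eq_norm ht ?_ fun k hk => ?_
    · rw [coeff_X_mul, hp.coeff_self]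
    · obtain ⟨k, rfl⟩ := Nat.exists_eq_succ_of_ne_zero (by omega : k ≠ 0)
      rw [Nat.succ_eq_add_one, coeff_X_mul, hp.coeff_of_lt (by omega)]
  rw [derivative_mul, mul_comm (p (n + 1)) (derivative (p n)), moment_add ht, h1, h2] at hparts
  rw [show X * (p (n + 1) * p n) = X * p n * p (n + 1) by ring] at hparts ⊢
  rw [h3] at hparts
  linarith

/-- Factorization of the weighted norms for polynomials of adjacent degrees, the even one being
`p e` and the odd one `p o`. -/
lemma moments_of_even_odd (ht : 0 < t) (hp : IsMonicOrthogonal t p) {e o : ℕ} (he : Even e)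
    (ho : Odd o) (heo : e ≤ o + 1) (hoe : o ≤ e + 1) :
    ∃ c q a b : ℝ, moment t 1 (p e * p e) = c * b ∧ moment t 1 (p o * p o) = q * a ∧
      moment t 2 (X * (p e * p o)) = q * b ∧
      (e < o → moment t 0 (p e * p e) = c * a) ∧
      (o < e → moment t 0 (p o * p o) = -(c * a)) := by
  set Q := divX (p o) with hQ
  set T := divX (divX Q) with hT
  set S := divX (divX (p e)) with hS
  set c := (p e).coeff 0
  set q := (p o).coeff 1
  have hO : p o = X * Q := by
    have := divX_mul_X_add (p o)
    rw [hp.coeff_eq_zero_of_odd ht (k := 0) ho] at this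
    rw [← this]; simp [hQ, mul_comm]
  have hQT : Q = C q + X ^ 2 * T := by
    have h1 := divX_mul_X_add Q
    have h2 := divX_mul_X_add (divX Q)
    have h3 : (divX Q).coeff 0 = 0 := by
      simpa only [hQ, coeff_divX] using hp.coeff_eq_zero_of_odd ht (k := 2) (ho.add_even even_two)
    have h4 : Q.coeff 0 = q := by simp only [hQ, coeff_divX, q]
    rw [h3, C_0, add_zero] at h2
    rw [← h2, h4] at h1
    rw [← h1]; ring
  have hE : p e = C c + X ^ 2 * S := by
    have h1 := divX_mul_X_add (p e)
    have h2 := divX_mul_X_add (divX (p e))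
    have h3 : (divX (p e)).coeff 0 = 0 := by
      simpa only [coeff_divX] using hp.coeff_eq_zero_of_odd ht (k := 1) (he.add_odd odd_one)
    rw [h3, C_0, add_zero] at h2
    rw [← h2] at h1
    rw [← h1]; ring
  have hScoeff : ∀ k, S.coeff k = (p e).coeff (k + 2) := fun k => by
    simp only [hS, coeff_divX]
  have hQcoeff : ∀ k, Q.coeff k = (p o).coeff (k + 1) := fun k => by
    simp only [hQ, coeff_divX]
  have hTcoeff : ∀ k, T.coeff k = (p o).coeff (k + 3) := fun k => by
    simp only [hT, coeff_divX, hQcoeff]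
  have hTo : moment t 0 (X * T * p o) = 0 := hp.moment_mul_eq_zero ht fun k hk => by
    obtain ⟨k, rfl⟩ := Nat.exists_eq_succ_of_ne_zero (by have := ho.pos; omega : k ≠ 0)
    rw [Nat.succ_eq_add_one, coeff_X_mul, hTcoeff, hp.coeff_of_lt (by omega)]
  have hTe : moment t 0 (T * p e) = 0 := hp.moment_mul_eq_zero ht fun k hk => by
    rw [hTcoeff, hp.coeff_of_lt (by omega)]
  have hSe : moment t 0 (S * p e) = 0 := hp.moment_mul_eq_zero ht fun k hk => by
    rw [hScoeff, hp.coeff_of_lt (by omega)]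
  refine ⟨c, q, moment t 0 Q, moment t 1 (p e), ?_, ?_, ?_, fun hlt => ?_, fun hlt => ?_⟩
  · have : p e * p e = C c * p e + X ^ 2 * (S * p e) := by
      nth_rewrite 1 [hE]; ring
    rw [this, moment_add ht, moment_C_mul, moment_succ_X_sq_mul, hSe, add_zero]
  · have : p o * p o = X ^ 2 * (C q * Q + X * T * p o) := by
      rw [hO]; nth_rewrite 2 [hQT]; ring
    rw [this, moment_succ_X_sq_mul, moment_add ht, moment_C_mul, hTo, add_zero]
  · have : X * (p e * p o) = X ^ 2 * (C q * p e + X ^ 2 * (T * p e)) := by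
      rw [hO, hQT]; ring
    rw [this, moment_succ_X_sq_mul, moment_add ht, moment_C_mul, moment_succ_X_sq_mul, hTe,
      add_zero]
  · obtain rfl : o = e + 1 := by omega
    have hSo : moment t 0 (X * S * p (e + 1)) = 0 := hp.moment_mul_eq_zero ht fun k hk => by
      obtain ⟨k, rfl⟩ := Nat.exists_eq_succ_of_ne_zero (by omega : k ≠ 0)
      rw [Nat.succ_eq_add_one, coeff_X_mul, hScoeff, hp.coeff_of_lt (by omega)]
    rw [← hp.moment_mul_eq_norm ht (q := Q) (by rw [hQcoeff, hp.coeff_self])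
      fun k hk => by rw [hQcoeff, hp.coeff_of_lt (by omega)]]
    have : Q * p e = C c * Q + X * S * p (e + 1) := by
      rw [hE, hO]; ring
    rw [this, moment_add ht, moment_C_mul, hSo, add_zero]
  · obtain rfl : e = o + 1 := by omega
    have hQe : moment t 0 (Q * p (o + 1)) = 0 := hp.moment_mul_eq_zero ht fun k hk => by
      rw [hQcoeff, hp.coeff_of_lt (by omega)]
    have hnorm := hp.moment_mul_eq_norm ht (n := o) (q := X * S)
      (by
        obtain ⟨k, rfl⟩ := Nat.exists_eq_succ_of_ne_zero ho.pos.ne'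
        rw [Nat.succ_eq_add_one, coeff_X_mul, hScoeff]
        exact hp.coeff_self _)
      (fun k hk => by
        obtain ⟨k, rfl⟩ := Nat.exists_eq_succ_of_ne_zero (by omega : k ≠ 0)
        rw [Nat.succ_eq_add_one, coeff_X_mul, hScoeff, hp.coeff_of_lt (by omega)])
    have : X * S * p o = Q * p (o + 1) - C c * Q := by
      rw [hE, hO]; ring
    rw [← hnorm, this, moment_sub ht, moment_C_mul, hQe, zero_sub]

lemma moment_one_mul_moment_one (ht : 0 < t) (hp : IsMonicOrthogonal t p) (n : ℕ) :
    moment t 1 (p (n + 1) * p (n + 1)) * moment t 1 (p n * p n) =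
      (-1) ^ n * (moment t 0 (p n * p n) * moment t 2 (X * (p (n + 1) * p n))) := by
  rcases n.even_or_odd with hn | hn
  · obtain ⟨c, q, a, b, h1, h2, h3, h4, -⟩ :=
      hp.moments_of_even_odd ht hn hn.add_one (by omega) le_rfl
    rw [h1, h2, mul_comm (p (n + 1)), h3, h4 (by omega), hn.neg_one_pow]
    ring
  · obtain ⟨c, q, a, b, h1, h2, h3, -, h5⟩ :=
      hp.moments_of_even_odd ht hn.add_one hn le_rfl (by omega)
    rw [h1, h2, h3, h5 (by omega), hn.neg_one_pow]
    ring

end IsMonicOrthogonal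

/-- Evolution of the norms: the derivative of `h n` is `-∫ y⁻² P n (y)² w(y,t) dy`. -/
lemma hasDerivAt_norm {P : ℕ → ℝ → ℝ[X]}
    (hP : ∀ t, 0 < t → IsMonicOrthogonal t fun n => P n t)
    (hcoeff : ∀ n k : ℕ, ∀ t : ℝ, 0 < t → DifferentiableAt ℝ (fun s => (P n s).coeff k) t)
    (n : ℕ) {t : ℝ} (ht : 0 < t) :
    HasDerivAt (fun s => moment s 0 (P n s * P n s)) (-moment t 1 (P n t * P n t)) t := by
  have hexp : ∀ s, 0 < s → ∀ m (q : ℝ[X]), ∀ u, 0 < u → moment u m (P n s * q) =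
      ∑ k ∈ Finset.range (n + 1), (P n s).coeff k * moment u m (X ^ k * q) := by
    intro s hs m q u ht'
    conv_lhs => rw [(P n s).as_sum_range_C_mul_X_pow, (hP s hs).natDegree_eq n, Finset.sum_mul]
    rw [moment_sum ht']
    refine Finset.sum_congr rfl fun k _ => ?_
    rw [mul_assoc, moment_C_mul]
  have hev : (fun s => moment s 0 (P n s * P n s)) =ᶠ[nhds t] fun s =>
      ∑ k ∈ Finset.range (n + 1), (P n s).coeff k * moment s 0 (X ^ k * P n t) := by
    filter_upwards [Ioi_mem_nhds ht] with s hs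
    rw [← hexp s hs 0 _ s hs, mul_comm (P n s) (P n t)]
    exact ((hP s hs).moment_mul_eq_norm hs ((hP t ht).coeff_self n)
      fun k hk => (hP t ht).coeff_of_lt hk).symm
  refine HasDerivAt.congr_of_eventuallyEq ?_ hev
  have hsum := HasDerivAt.fun_sum (u := Finset.range (n + 1)) fun k _ =>
    (hcoeff n k t ht).hasDerivAt.fun_mul (hasDerivAt_moment ht (X ^ k * P n t))
  refine hsum.congr_deriv ?_
  rw [Finset.sum_add_distrib, Finset.sum_eq_zero, zero_add, hexp t ht 1 _ t ht,
    ← Finset.sum_neg_distrib]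
  · exact Finset.sum_congr rfl fun k _ => by ring
  · intro k hk
    rcases (Nat.lt_succ_iff.1 (Finset.mem_range.1 hk)).eq_or_lt with rfl | hk
    · have hconst : (fun s => (P k s).coeff k) =ᶠ[nhds t] fun _ => 1 := by
        filter_upwards [Ioi_mem_nhds ht] with s hs using (hP s hs).coeff_self k
      rw [hconst.deriv_eq, deriv_const, zero_mul]
    · rw [(hP t ht).moment_mul_eq_zero ht (fun j hj => ?_), mul_zero]
      rw [coeff_X_pow, if_neg (by omega)]

theorem statement14
    (P : ℕ → ℝ → Polynomial ℝ)
    (hmonic : ∀ n : ℕ, ∀ t : ℝ, 0 < t → (P n t).Monic)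
    (hdeg : ∀ n : ℕ, ∀ t : ℝ, 0 < t → (P n t).natDegree = n)
    (horth : ∀ m n : ℕ, m ≠ n → ∀ t : ℝ, 0 < t →
      ∫ x : ℝ, (P m t).eval x * (P n t).eval x * w t x = 0)
    (hcoeff : ∀ n k : ℕ, ∀ t : ℝ, 0 < t →
      DifferentiableAt ℝ (fun s => (P n s).coeff k) t)
    (h : ℕ → ℝ → ℝ)
    (hh : ∀ n : ℕ, ∀ t : ℝ, 0 < t → h n t = ∫ x : ℝ, ((P n t).eval x) ^ 2 * w t x)
    (hhpos : ∀ n : ℕ, ∀ t : ℝ, 0 < t → 0 < h n t)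
    (R : ℕ → ℝ → ℝ)
    (hR : ∀ n : ℕ, ∀ t : ℝ, 0 < t →
      R n t = 2 * t / h n t * ∫ y : ℝ, ((P n t).eval y) ^ 2 / y ^ 2 * w t y)
    (r : ℕ → ℝ → ℝ)
    (hr : ∀ n : ℕ, 1 ≤ n → ∀ t : ℝ, 0 < t → r n t = 2 * t / h (n - 1) t *
      ∫ y : ℝ, (P n t).eval y * (P (n - 1) t).eval y / y ^ 3 * w t y)
    (hRpos : ∀ n : ℕ, ∀ t : ℝ, 0 < t → 0 < R n t)
    (n : ℕ) (hn : 1 ≤ n) (t₀ : ℝ) (ht₀ : 0 < t₀) :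
    HasDerivAt (r n)
      (-2 * (-1 : ℝ) ^ n * r n t₀ / R n t₀ - ((n : ℝ) + r n t₀) * R n t₀ / (2 * t₀))
      t₀ := by
  obtain ⟨n, rfl⟩ : ∃ m, n = m + 1 := ⟨n - 1, by omega⟩
  have hh' : ∀ n t, 0 < t → h n t = moment t 0 (P n t * P n t) := fun n t ht => by
    simp [hh n t ht, moment, sq]
  have hP : ∀ t, 0 < t → IsMonicOrthogonal t fun n => P n t := fun t ht =>
    { monic := fun n => hmonic n t ht
      natDegree_eq := fun n => hdeg n t ht
      orthogonal := fun m n hmn => by simpa [moment] using horth m n hmn t ht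
      norm_pos := fun n => by rw [← hh' n t ht]; exact hhpos n t ht }
  have hR' : R (n + 1) t₀ =
      2 * t₀ / h (n + 1) t₀ * moment t₀ 1 (P (n + 1) t₀ * P (n + 1) t₀) := by
    simp [hR _ t₀ ht₀, moment, sq, div_eq_mul_inv]
  have hr' : ∀ t, 0 < t → r (n + 1) t =
      2 * t / h n t * moment t 2 (X * (P (n + 1) t * P n t)) := fun t ht => by
    rw [hr (n + 1) hn t ht, Nat.add_sub_cancel, moment]
    congr 2 with x
    rcases eq_or_ne x 0 with rfl | hx
    · simp [w_zero]
    · simp only [eval_mul, eval_X]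
      field_simp
  have hrβ : ∀ t, 0 < t → r (n + 1) t = 2 * h (n + 1) t / h n t - (n + 1) := fun t ht => by
    have hrec := (hP t ht).two_mul_norm_succ ht n
    simp only [← hh' _ t ht] at hrec
    have hne := (hhpos n t ht).ne'
    rw [hr' t ht, hrec]
    field_simp
    ring
  have hderiv : ∀ m, HasDerivAt (h m) (-moment t₀ 1 (P m t₀ * P m t₀)) t₀ := fun m => by
    refine (hasDerivAt_norm hP hcoeff m ht₀).congr_of_eventuallyEq ?_
    filter_upwards [Ioi_mem_nhds ht₀] with t ht using hh' m t ht
  have hev : r (n + 1) =ᶠ[nhds t₀] fun t => 2 * h (n + 1) t / h n t - (n + 1) := by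
    filter_upwards [Ioi_mem_nhds ht₀] with t ht using hrβ t ht
  refine HasDerivAt.congr_of_eventuallyEq ?_ hev
  have hn0 := (hhpos n t₀ ht₀).ne'
  have hn1 := (hhpos (n + 1) t₀ ht₀).ne'
  refine ((((hderiv (n + 1)).const_mul 2).fun_div (hderiv n) hn0).sub_const _).congr_deriv ?_
  have hprod := (hP t₀ ht₀).moment_one_mul_moment_one ht₀ n
  rw [← hh' n t₀ ht₀] at hprod
  have hK : moment t₀ 1 (P (n + 1) t₀ * P (n + 1) t₀) ≠ 0 := fun h0 => by
    have := hRpos (n + 1) t₀ ht₀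
    rw [hR', h0, mul_zero] at this
    exact this.false
  have hsum : ((n + 1 : ℕ) : ℝ) + r (n + 1) t₀ = 2 * h (n + 1) t₀ / h n t₀ := by
    rw [hrβ t₀ ht₀]; push_cast; ring
  rw [hsum, hr' t₀ ht₀, hR', pow_succ]
  field_simp
  linear_combination h (n + 1) t₀ * hprod
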